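/- Let K = 3 and consider a 1-to-3 broadcast PEC with parameters p_S (S ⊆ [3]) such that p_k > 0 for every k ∈ [3]. Let (R_1, R_2, R_3) be a vector of nonnegative reals satisfying the strict outer-bound inequalities ∑_{j=1}^3 R_{π(j)}/p_{∪S_j^π} < 1 for every permutation π of [3]. Then for every cardinality-compatible strict total order ≺ on the subsets of [3] there exist LP-feasible variables for (R_1, R_2, R_3) with respect to ≺. (This is the achievability core of the result that the outer bound is the capacity region for all 1-to-3 broadcast PECs with channel output feedback.) -/

import Mathlib

open Finset
open scoped Classical

/-- `pCup p S` is the probability that at least one receiver in `S` receives the packet: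
the sum of `p S'` over all `S'` intersecting `S`. -/
def pCup {K : ℕ} (p : Finset (Fin K) → ℝ) (S : Finset (Fin K)) : ℝ :=
  ∑ S' ∈ Finset.univ.filter (fun S' : Finset (Fin K) => (S' ∩ S).Nonempty), p S'

/-- `fp p S T` is the probability that the packet is received by all receivers in `S`
and by none in `T`: the sum of `p S₁` over all `S₁` with `S ⊆ S₁ ⊆ [K]∖T`. -/
def fp {K : ℕ} (p : Finset (Fin K) → ℝ) (S T : Finset (Fin K)) : ℝ :=
  ∑ S1 ∈ Finset.univ.filter (fun S1 : Finset (Fin K) => S ⊆ S1 ∧ S1 ⊆ Finset.univ \ T), p S1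

/-- A strict total order `ord` on the subsets of `[K]` is cardinality-compatible if
`|S₁| < |S₂|` implies `ord S₁ S₂`. -/
def CardCompatible {K : ℕ} (ord : Finset (Fin K) → Finset (Fin K) → Prop) : Prop :=
  IsStrictTotalOrder (Finset (Fin K)) ord ∧
    ∀ S1 S2 : Finset (Fin K), S1.card < S2.card → ord S1 S2

/-- The variables `x S` (for `S ⊆ [K]`) and `w k S T` (for `k ∈ [K]`, `T ⊆ S ⊆ [K]∖{k}`)
are LP-feasible for the rate vector `R` with respect to the cardinality-compatible strict
total order `ord`: they are nonnegative and satisfy the inequalities (4)-(8) of the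
inner-bound linear program. -/
def LPFeasible {K : ℕ} (p : Finset (Fin K) → ℝ) (R : Fin K → ℝ)
    (ord : Finset (Fin K) → Finset (Fin K) → Prop)
    (x : Finset (Fin K) → ℝ)
    (w : Fin K → Finset (Fin K) → Finset (Fin K) → ℝ) : Prop :=
  -- nonnegativity of the `x` variables
  (∀ S : Finset (Fin K), 0 ≤ x S) ∧
  -- nonnegativity of the `w` variables
  (∀ k : Fin K, ∀ S T : Finset (Fin K), T ⊆ S → S ⊆ Finset.univ \ {k} → 0 ≤ w k S T) ∧
  -- (i): ∑_S x_S < 1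
  (∑ S : Finset (Fin K), x S < 1) ∧
  -- (ii): for every T ⊆ [K] and k ∈ T
  (∀ T : Finset (Fin K), ∀ k ∈ T,
      x T ≥ ∑ S ∈ Finset.univ.filter
          (fun S : Finset (Fin K) => T \ {k} ⊆ S ∧ S ⊆ Finset.univ \ {k}),
        w k S (T \ {k})) ∧
  -- (iii): w_{k;∅→∅}·p_{∪[K]} ≥ R_k
  (∀ k : Fin K, w k ∅ ∅ * pCup p Finset.univ ≥ R k) ∧
  -- (iv): for every k and nonempty S ⊆ [K]∖{k}
  (∀ k : Fin K, ∀ S : Finset (Fin K), S ⊆ Finset.univ \ {k} → S.Nonempty →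
      (∑ T1 ∈ S.powerset, w k S T1) * pCup p (Finset.univ \ S) ≥
        ∑ ST ∈ (Finset.univ : Finset (Finset (Fin K) × Finset (Fin K))).filter
            (fun ST => ST.2 ⊆ ST.1 ∧ ST.1 ⊆ Finset.univ \ {k} ∧
              ST.2 ⊆ S ∧ ¬ S ⊆ ST.1),
          w k ST.1 ST.2 * fp p (S \ ST.2) (Finset.univ \ S)) ∧
  -- (v): for every k and T ⊊ S ⊆ [K]∖{k}
  (∀ k : Fin K, ∀ S T : Finset (Fin K), T ⊆ S → S ⊆ Finset.univ \ {k} → T ≠ S →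
      (w k S T +
          ∑ T1 ∈ S.powerset.filter (fun T1 => ord (insert k T1) (insert k T)), w k S T1)
        * pCup p (Finset.univ \ S) ≤
      (∑ S1 ∈ Finset.univ.filter
          (fun S1 : Finset (Fin K) => ord S1 S ∧ T ⊆ S1 ∧ S1 ⊆ Finset.univ \ {k}),
        w k S1 T * fp p (S \ T) (Finset.univ \ S)) +
      ∑ ST ∈ (Finset.univ : Finset (Finset (Fin K) × Finset (Fin K))).filter
          (fun ST => ST.2 ⊆ ST.1 ∧ ST.1 ⊆ Finset.univ \ {k} ∧
            ord (insert k ST.2) (insert k T) ∧ ST.2 ⊆ S ∧ ¬ S ⊆ ST.1),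
        w k ST.1 ST.2 * fp p (S \ ST.2) (Finset.univ \ S))

lemma sum_finset_fin_three (g : Finset (Fin 3) → ℝ) :
    ∑ S, g S = g ∅ + g {0} + g {1} + g {2} + g {0, 1} + g {0, 2} + g {1, 2} + g {0, 1, 2} := by
  have h : (Finset.univ : Finset (Finset (Fin 3))) =
      {∅, {0}, {1}, {2}, {0, 1}, {0, 2}, {1, 2}, {0, 1, 2}} := by decide
  rw [h]
  repeat rw [Finset.sum_insert (by decide)]
  rw [Finset.sum_singleton]
  ring

lemma forall_finset_fin_three {Q : Finset (Fin 3) → Prop} :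
    (∀ S, Q S) ↔ Q ∅ ∧ Q {0} ∧ Q {1} ∧ Q {2} ∧ Q {0, 1} ∧ Q {0, 2} ∧ Q {1, 2} ∧ Q {0, 1, 2} := by
  refine ⟨fun h => ⟨h _, h _, h _, h _, h _, h _, h _, h _⟩, ?_⟩
  rintro ⟨h0, h1, h2, h3, h4, h5, h6, h7⟩ S
  have h : ∀ S : Finset (Fin 3), S = ∅ ∨ S = {0} ∨ S = {1} ∨ S = {2} ∨ S = {0, 1} ∨ S = {0, 2} ∨
      S = {1, 2} ∨ S = {0, 1, 2} := by decide
  rcases h S with rfl | rfl | rfl | rfl | rfl | rfl | rfl | rfl <;> assumption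

lemma sum_powerset_eq_ite {K : ℕ} (S : Finset (Fin K)) (g : Finset (Fin K) → ℝ) :
    ∑ T ∈ S.powerset, g T = ∑ T, if T ⊆ S then g T else 0 := by
  rw [← Finset.sum_filter]
  congr 1
  ext T
  simp

/-- The rates at which receiver `k`'s packets overheard by exactly `S` are sent in the session
`insert k T`: packets stay in the session matching `S`, except that those overheard by both other
receivers are moved at rate `m k j` to the session `{k, j}`. -/
def sessionRate (a : Fin 3 → ℝ) (b : Fin 3 → Fin 3 → ℝ) (c : Fin 3 → ℝ) (m : Fin 3 → Fin 3 → ℝ)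
    (k : Fin 3) (S T : Finset (Fin 3)) : ℝ :=
  if T = S then
    if S.card = 0 then a k else if S.card = 1 then ∑ j ∈ S, b k j else c k - ∑ j ∈ S, m k j
  else if S.card = 2 ∧ T.card = 1 then ∑ j ∈ T, m k j else 0

/-- The time allotted to each session. -/
def sessionTime (a : Fin 3 → ℝ) (y : Fin 3 → Fin 3 → ℝ) (X : ℝ) (S : Finset (Fin 3)) : ℝ :=
  if S = {0} then a 0 else if S = {1} then a 1 else if S = {2} then a 2
  else if S = {0, 1} then y 0 1 else if S = {0, 2} then y 0 2
  else if S = {1, 2} then y 1 2 else if S = {0, 1, 2} then X else 0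

section sessionRate

variable (a : Fin 3 → ℝ) (b : Fin 3 → Fin 3 → ℝ) (c : Fin 3 → ℝ) (m : Fin 3 → Fin 3 → ℝ)
  (k j l : Fin 3)

lemma sessionRate_empty : sessionRate a b c m k ∅ ∅ = a k := by simp [sessionRate]

lemma sessionRate_singleton_self : sessionRate a b c m k {j} {j} = b k j := by simp [sessionRate]

lemma sessionRate_singleton_empty : sessionRate a b c m k {j} ∅ = 0 := by
  simp [sessionRate, (Finset.singleton_ne_empty j).symm]

variable {j l}

lemma sessionRate_pair_self (h : j ≠ l) :
    sessionRate a b c m k {j, l} {j, l} = c k - (m k j + m k l) := by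
  simp [sessionRate, Finset.card_pair h, Finset.sum_pair h]

lemma sessionRate_pair_left (h : j ≠ l) : sessionRate a b c m k {j, l} {j} = m k j := by
  have h1 : ({j} : Finset (Fin 3)) ≠ {j, l} := fun h' => by
    have := congrArg Finset.card h'
    simp [Finset.card_pair h] at this
  simp [sessionRate, Finset.card_pair h, h1]

lemma sessionRate_pair_right (h : j ≠ l) : sessionRate a b c m k {j, l} {l} = m k l := by
  rw [Finset.pair_comm, sessionRate_pair_left _ _ _ _ _ h.symm]

lemma sessionRate_pair_empty : sessionRate a b c m k {j, l} ∅ = 0 := by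
  have h1 : (∅ : Finset (Fin 3)) ≠ {j, l} := (Finset.insert_ne_empty _ _).symm
  simp [sessionRate, h1]

end sessionRate

lemma pCup_fin_three_values (p : Finset (Fin 3) → ℝ) :
    pCup p {0} = p {0} + p {0, 1} + p {0, 2} + p {0, 1, 2} ∧
    pCup p {1} = p {1} + p {0, 1} + p {1, 2} + p {0, 1, 2} ∧
    pCup p {2} = p {2} + p {0, 2} + p {1, 2} + p {0, 1, 2} ∧
    pCup p {0, 1} = p {0} + p {1} + p {0, 1} + p {0, 2} + p {1, 2} + p {0, 1, 2} ∧
    pCup p {0, 2} = p {0} + p {2} + p {0, 1} + p {0, 2} + p {1, 2} + p {0, 1, 2} ∧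
    pCup p {1, 2} = p {1} + p {2} + p {0, 1} + p {0, 2} + p {1, 2} + p {0, 1, 2} ∧
    pCup p Finset.univ =
      p {0} + p {1} + p {2} + p {0, 1} + p {0, 2} + p {1, 2} + p {0, 1, 2} := by
  refine ⟨?_, ?_, ?_, ?_, ?_, ?_, ?_⟩ <;>
    simp (decide := true) [pCup, Finset.sum_filter, sum_finset_fin_three]

lemma fp_fin_three_values (p : Finset (Fin 3) → ℝ) :
    fp p {0} {1, 2} = p {0} ∧ fp p {1} {0, 2} = p {1} ∧ fp p {2} {0, 1} = p {2} ∧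
    fp p {0} {1} = p {0} + p {0, 2} ∧ fp p {0} {2} = p {0} + p {0, 1} ∧
    fp p {1} {0} = p {1} + p {1, 2} ∧ fp p {1} {2} = p {1} + p {0, 1} ∧
    fp p {2} {0} = p {2} + p {1, 2} ∧ fp p {2} {1} = p {2} + p {0, 2} ∧
    fp p {0, 1} {2} = p {0, 1} ∧ fp p {0, 2} {1} = p {0, 2} ∧ fp p {1, 2} {0} = p {1, 2} := by
  refine ⟨?_, ?_, ?_, ?_, ?_, ?_, ?_, ?_, ?_, ?_, ?_, ?_⟩ <;>
    simp (decide := true) [fp, Finset.sum_filter, sum_finset_fin_three]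

lemma exists_moves {A b12 b21 b13 b31 b23 b32 c1 c2 c3 u21 u31 u32 : ℝ}
    (hc1 : 0 ≤ c1) (hc2 : 0 ≤ c2) (hc3 : 0 ≤ c3) (hu21 : 0 ≤ u21) (hu31 : 0 ≤ u31)
    (hu32 : 0 ≤ u32) (huc21 : u21 ≤ c2) (huc31 : u31 ≤ c3) (huc32 : u32 ≤ c3)
    (h21 : u21 ≤ b12 - b21 → c2 - u21 ≤ c1) (h31 : u31 ≤ b13 - b31 → c3 - u31 ≤ c1)
    (h32 : u32 ≤ b23 - b32 → c3 - u32 ≤ c1)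
    (d12 : b21 ≤ b12) (d13 : b31 ≤ b13) (d23 : b32 ≤ b23)
    (o1 : A + b12 + b13 + b23 + c1 < 1) (o2 : A + b21 + b13 + b23 + c2 < 1)
    (o3 : A + b12 + b31 + b32 + c3 < 1) :
    ∃ m21 m31 m32 X, 0 ≤ m21 ∧ 0 ≤ m31 ∧ 0 ≤ m32 ∧
      m21 ≤ b12 - b21 ∧ m31 ≤ b13 - b31 ∧ m32 ≤ b23 - b32 ∧
      m21 ≤ u21 ∧ m31 ≤ u31 ∧ m32 ≤ u32 ∧ m21 ≤ c2 ∧ m31 + m32 ≤ c3 ∧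
      c1 ≤ X ∧ c2 - m21 ≤ X ∧ c3 - (m31 + m32) ≤ X ∧ A + b12 + b13 + b23 + X < 1 := by
  have H2 : ∃ m21, 0 ≤ m21 ∧ m21 ≤ b12 - b21 ∧ m21 ≤ u21 ∧ m21 ≤ c2 ∧
      A + b12 + b13 + b23 + (c2 - m21) < 1 := by
    rcases le_total u21 (b12 - b21) with h | h
    · exact ⟨u21, hu21, h, le_rfl, huc21, by linarith [h21 h]⟩
    · rcases le_total (b12 - b21) c2 with h' | h'
      · exact ⟨b12 - b21, by linarith, le_rfl, h, h', by linarith⟩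
      · exact ⟨c2, hc2, h', by linarith, le_rfl, by linarith⟩
  have H3 : ∃ m31 m32, 0 ≤ m31 ∧ 0 ≤ m32 ∧ m31 ≤ b13 - b31 ∧ m32 ≤ b23 - b32 ∧ m31 ≤ u31 ∧
      m32 ≤ u32 ∧ m31 + m32 ≤ c3 ∧ A + b12 + b13 + b23 + (c3 - (m31 + m32)) < 1 := by
    rcases le_total u31 (b13 - b31) with h | h
    · exact ⟨u31, 0, hu31, le_rfl, h, by linarith, le_rfl, hu32, by linarith, by linarith [h31 h]⟩
    rcases le_total u32 (b23 - b32) with h' | h'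
    · exact ⟨0, u32, le_rfl, hu32, by linarith, h', hu31, le_rfl, by linarith,
        by linarith [h32 h']⟩
    rcases le_total (b13 - b31) c3 with h'' | h''
    · rcases le_total (b13 - b31 + (b23 - b32)) c3 with h3 | h3
      · exact ⟨_, _, sub_nonneg.2 d13, sub_nonneg.2 d23, le_rfl, le_rfl, h, h', h3, by linarith⟩
      · exact ⟨b13 - b31, c3 - (b13 - b31), by linarith, by linarith, le_rfl, by linarith, h,
          by linarith, by linarith, by linarith⟩
    · exact ⟨c3, 0, hc3, le_rfl, h'', by linarith, by linarith, hu32, by linarith, by linarith⟩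
  obtain ⟨m21, p1, p2, p3, p4, p5⟩ := H2
  obtain ⟨m31, m32, q1, q2, q3, q4, q5, q6, q7, q8⟩ := H3
  refine ⟨m21, m31, m32, max c1 (max (c2 - m21) (c3 - (m31 + m32))), p1, q1, q2, p2, q3, q4, p3,
    q5, q6, p4, q7, le_max_left _ _, (le_max_left _ _).trans (le_max_right _ _),
    (le_max_right _ _).trans (le_max_right _ _), ?_⟩
  rw [← lt_sub_iff_add_lt', max_lt_iff, max_lt_iff]
  exact ⟨by linarith, by linarith, by linarith⟩

lemma fp_eq_pCup_sub (p : Finset (Fin 3) → ℝ) {i j k : Fin 3} (hij : i ≠ j) (hjk : j ≠ k)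
    (hik : i ≠ k) :
    fp p {j} {i, k} = pCup p univ - pCup p {i, k} ∧
    fp p {k} {i} = pCup p {i, k} - pCup p {i} ∧
    fp p {j, k} {i} = pCup p {i, j} + pCup p {i, k} - pCup p {i} - pCup p univ := by
  obtain ⟨c1, c2, c3, c4, c5, c6, c7⟩ := pCup_fin_three_values p
  obtain ⟨f1, f2, f3, f4, f5, f6, f7, f8, f9, f10, f11, f12⟩ := fp_fin_three_values p
  have w1 : ({1, 0} : Finset (Fin 3)) = {0, 1} := by decide
  have w2 : ({2, 0} : Finset (Fin 3)) = {0, 2} := by decide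
  have w3 : ({2, 1} : Finset (Fin 3)) = {1, 2} := by decide
  fin_cases i <;> fin_cases j <;> first | exact absurd rfl hij | skip
  all_goals fin_cases k <;> first | exact absurd rfl hik | exact absurd rfl hjk | skip
  all_goals
    simp only [Fin.zero_eta, Fin.mk_one, Fin.reduceFinMk, w1, w2, w3, c1, c2, c3, c4, c5, c6, c7,
      f1, f2, f3, f4, f5, f6, f7, f8, f9, f10, f11, f12]
    refine ⟨?_, ?_, ?_⟩ <;> ring

lemma fp_nonneg {p : Finset (Fin 3) → ℝ} (hp : ∀ S, 0 ≤ p S) (S T : Finset (Fin 3)) :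
    0 ≤ fp p S T :=
  Finset.sum_nonneg fun _ _ => hp _

lemma sum_outer_lt_one {p : Finset (Fin 3) → ℝ} {R : Fin 3 → ℝ}
    (houter : ∀ π : Equiv.Perm (Fin 3),
      ∑ j : Fin 3,
        R (π j) / pCup p ((Finset.univ.filter (fun i : Fin 3 => i ≤ j)).image π) < 1)
    {i j k : Fin 3} (hij : i ≠ j) (hjk : j ≠ k) (hik : i ≠ k) :
    R i / pCup p {i} + R j / pCup p {i, j} + R k / pCup p univ < 1 := by
  have hinj : Function.Injective ![i, j, k] := by
    intro x y
    fin_cases x <;> fin_cases y <;> simp [hij, hjk, hik, hij.symm, hjk.symm, hik.symm]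
  have h := houter (Equiv.ofBijective _ (Finite.injective_iff_bijective.1 hinj))
  have e0 : Finset.univ.filter (fun i : Fin 3 => i ≤ 0) = {0} := by decide
  have e1 : Finset.univ.filter (fun i : Fin 3 => i ≤ 1) = {0, 1} := by decide
  have e2 : Finset.univ.filter (fun i : Fin 3 => i ≤ 2) = Finset.univ := by decide
  rw [Fin.sum_univ_three, e0, e1, e2, Finset.image_univ_equiv] at h
  simpa using h

lemma mul_sub_mul_sub_le {P1 P12 P13 P : ℝ} (h1 : 0 < P1) (h2 : P1 ≤ P12) (h3 : P1 ≤ P13)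
    (h4 : P12 ≤ P) (h : P + P1 ≤ P12 + P13) :
    (1 / P13 - 1 / P) * (1 / P12 - 1 / P) * P ≤ 1 / P1 + 1 / P - 1 / P12 - 1 / P13 := by
  have h12 : 0 < P12 := by linarith
  have h13 : 0 < P13 := by linarith
  have hP : 0 < P := by linarith
  have : P * P1 ≤ P12 * P13 := by nlinarith
  have e : 1 / P1 + 1 / P - 1 / P12 - 1 / P13 - (1 / P13 - 1 / P) * (1 / P12 - 1 / P) * P =
      (P12 * P13 - P * P1) / (P1 * P12 * P13) := by
    field_simp
    ring
  have : 0 ≤ (P12 * P13 - P * P1) / (P1 * P12 * P13) :=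
    div_nonneg (by linarith) (by positivity)
  linarith

lemma lpFeasible_sessionRate {p : Finset (Fin 3) → ℝ} (hp : ∀ S, 0 ≤ p S) {R : Fin 3 → ℝ}
    {ord : Finset (Fin 3) → Finset (Fin 3) → Prop} (hord : CardCompatible ord)
    {a : Fin 3 → ℝ} {b : Fin 3 → Fin 3 → ℝ} {c : Fin 3 → ℝ} {m : Fin 3 → Fin 3 → ℝ} 
    {y : Fin 3 → Fin 3 → ℝ} {X : ℝ}
    (ha : ∀ i, 0 ≤ a i) (hb : ∀ i j, 0 ≤ b i j) (hm : ∀ i j, 0 ≤ m i j) (hX : 0 ≤ X)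
    (haR : ∀ i, a i * pCup p Finset.univ = R i)
    (hbp : ∀ i j k : Fin 3, i ≠ j → j ≠ k → i ≠ k →
      b i j * pCup p {i, k} = a i * fp p {j} {i, k})
    (hcp : ∀ i j k : Fin 3, i ≠ j → j ≠ k → i ≠ k →
      c i * pCup p {i} = a i * fp p {j, k} {i} + b i j * fp p {k} {i} + b i k * fp p {j} {i})
    (hmp : ∀ i j k : Fin 3, i ≠ j → j ≠ k → i ≠ k →
      m i j * pCup p {i} ≤ a i * fp p {j, k} {i} + b i j * fp p {k} {i})
    (hmc : ∀ i j k : Fin 3, i ≠ j → j ≠ k → i ≠ k → m i j + m i k ≤ c i)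
    (hmb : ∀ i j : Fin 3, i ≠ j → b i j + m i j ≤ y i j) (hy : ∀ i j, y i j = y j i)
    (hcX : ∀ i j k : Fin 3, i ≠ j → j ≠ k → i ≠ k → c i - (m i j + m i k) ≤ X)
    (hlt : a 0 + a 1 + a 2 + y 0 1 + y 0 2 + y 1 2 + X
      < 1) :
    LPFeasible p R ord (sessionTime a y X) (sessionRate a b c m) := by
  have u1 : (Finset.univ : Finset (Fin 3)) \ {0} = {1, 2} := by decide
  have u2 : (Finset.univ : Finset (Fin 3)) \ {1} = {0, 2} := by decide
  have u3 : (Finset.univ : Finset (Fin 3)) \ {2} = {0, 1} := by decide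
  have u4 : (Finset.univ : Finset (Fin 3)) \ {0, 1} = {2} := by decide
  have u5 : (Finset.univ : Finset (Fin 3)) \ {0, 2} = {1} := by decide
  have u6 : (Finset.univ : Finset (Fin 3)) \ {1, 2} = {0} := by decide
  have v1 : ({0, 1} : Finset (Fin 3)) \ {0} = {1} := by decide
  have v2 : ({0, 1} : Finset (Fin 3)) \ {1} = {0} := by decide
  have v3 : ({0, 2} : Finset (Fin 3)) \ {0} = {2} := by decide
  have v4 : ({0, 2} : Finset (Fin 3)) \ {2} = {0} := by decide
  have v5 : ({1, 2} : Finset (Fin 3)) \ {1} = {2} := by decide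
  have v6 : ({1, 2} : Finset (Fin 3)) \ {2} = {1} := by decide
  have t1 : ({0, 1, 2} : Finset (Fin 3)) \ {0} = {1, 2} := by decide
  have t2 : ({0, 1, 2} : Finset (Fin 3)) \ {1} = {0, 2} := by decide
  have t3 : ({0, 1, 2} : Finset (Fin 3)) \ {2} = {0, 1} := by decide
  have w1 : ({1, 0} : Finset (Fin 3)) = {0, 1} := by decide
  have w2 : ({2, 0} : Finset (Fin 3)) = {0, 2} := by decide
  have w3 : ({2, 1} : Finset (Fin 3)) = {1, 2} := by decide
  have f : ∀ S T, 0 ≤ fp p S T := fun S T => Finset.sum_nonneg fun _ _ => hp _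
  have := hord.1
  have hirr : ∀ S, ¬ ord S S := irrefl
  have hlt_card : ∀ S T : Finset (Fin 3), S.card < T.card → ord S T := hord.2
  have hnlt_card : ∀ S T : Finset (Fin 3), T.card < S.card → ¬ ord S T :=
    fun S T h h' => hirr S (_root_.trans h' (hord.2 _ _ h))
  have hmb' : ∀ i j, i ≠ j → b i j + m i j ≤ y j i := fun i j h => hy i j ▸ hmb i j h
  have haf : ∀ i S T, 0 ≤ a i * fp p S T := fun i S T => mul_nonneg (ha i) (f S T)
  have hy0 : ∀ i j, i ≠ j → 0 ≤ y i j := fun i j h =>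
    (add_nonneg (hb i j) (hm i j)).trans (hmb i j h)
  refine ⟨?_, ?_, ?_, ?_, ?_, ?_, ?_⟩
  · simp (decide := true) [forall_finset_fin_three, sessionTime, ha, hy0, hX]
  · simp (decide := true) [forall_finset_fin_three, Fin.forall_fin_succ, sessionRate_empty,
      sessionRate_singleton_self, sessionRate_singleton_empty, sessionRate_pair_self,
      sessionRate_pair_left, sessionRate_pair_right, sessionRate_pair_empty, ha, hb, hm, hmc]
  · rw [sum_finset_fin_three]
    simpa (decide := true) [sessionTime] using hlt
  · simp (decide := true) [forall_finset_fin_three, Finset.sum_filter, sum_finset_fin_three,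
      sessionRate_empty, v1, v2, v3, v4, v5, v6, t1, t2, t3,
      sessionRate_singleton_self, sessionRate_singleton_empty, sessionRate_pair_self,
      sessionRate_pair_left, sessionRate_pair_right, sessionRate_pair_empty, sessionTime,
      hmb, hmb', hcX]
  · intro k
    rw [sessionRate_empty, haR]
  · simp (decide := true) [forall_finset_fin_three, Fin.forall_fin_succ, Finset.sum_filter,
      Fintype.sum_prod_type, sum_powerset_eq_ite, sum_finset_fin_three,
      sessionRate_empty, u1, u2, u3, u4, u5, u6, v1, v2, v3, v4, v5, v6,
      sessionRate_singleton_self, sessionRate_singleton_empty, sessionRate_pair_self,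
      sessionRate_pair_left, sessionRate_pair_right, sessionRate_pair_empty]
    have e {i j k : Fin 3} (h1 : i ≠ j) (h2 : j ≠ k) (h3 : i ≠ k) :=
      And.intro (hbp i j k h1 h2 h3) (hcp i j k h1 h2 h3)
    obtain ⟨e1, e2⟩ := e (i := 0) (j := 1) (k := 2) (by decide) (by decide) (by decide)
    obtain ⟨e3, -⟩ := e (i := 0) (j := 2) (k := 1) (by decide) (by decide) (by decide)
    obtain ⟨e4, e5⟩ := e (i := 1) (j := 0) (k := 2) (by decide) (by decide) (by decide)
    obtain ⟨e6, -⟩ := e (i := 1) (j := 2) (k := 0) (by decide) (by decide) (by decide)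
    obtain ⟨e7, e8⟩ := e (i := 2) (j := 0) (k := 1) (by decide) (by decide) (by decide)
    obtain ⟨e9, -⟩ := e (i := 2) (j := 1) (k := 0) (by decide) (by decide) (by decide)
    simp only [w1, w2, w3] at e1 e2 e3 e4 e5 e6 e7 e8 e9
    rw [e1, e2, e3, e4, e5, e6, e7, e8, e9]
    refine ⟨⟨?_, ?_, ?_⟩, ⟨?_, ?_, ?_⟩, ?_, ?_, ?_⟩ <;> linarith
  · simp (decide := true) [forall_finset_fin_three, Fin.forall_fin_succ, Finset.sum_filter,
      Fintype.sum_prod_type, sum_powerset_eq_ite, sum_finset_fin_three,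
      sessionRate_empty, u1, u2, u3, u4, u5, u6, v1, v2, v3, v4, v5, v6, w1, w2, w3,
      sessionRate_singleton_self, sessionRate_singleton_empty, sessionRate_pair_self,
      sessionRate_pair_left, sessionRate_pair_right, sessionRate_pair_empty]
    simp (decide := true) [hlt_card, hnlt_card, hirr]
    have key {i j k : Fin 3} (h1 : i ≠ j) (h2 : j ≠ k) (h3 : i ≠ k) :
        m i j * pCup p {i} ≤ a i * fp p {j, k} {i} + b i j * fp p {k} {i} ∧
        (m i j + m i k) * pCup p {i} ≤
          a i * fp p {j, k} {i} + b i j * fp p {k} {i} + b i k * fp p {j} {i} := by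
      refine ⟨hmp i j k h1 h2 h3, ?_⟩
      rw [← hcp i j k h1 h2 h3]
      exact mul_le_mul_of_nonneg_right (hmc i j k h1 h2 h3) (Finset.sum_nonneg fun _ _ => hp _)
    obtain ⟨k1, k2⟩ := key (i := 0) (j := 1) (k := 2) (by decide) (by decide) (by decide)
    obtain ⟨k3, -⟩ := key (i := 0) (j := 2) (k := 1) (by decide) (by decide) (by decide)
    obtain ⟨k4, k5⟩ := key (i := 1) (j := 0) (k := 2) (by decide) (by decide) (by decide)
    obtain ⟨k6, -⟩ := key (i := 1) (j := 2) (k := 0) (by decide) (by decide) (by decide)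
    obtain ⟨k7, k8⟩ := key (i := 2) (j := 0) (k := 1) (by decide) (by decide) (by decide)
    obtain ⟨k9, -⟩ := key (i := 2) (j := 1) (k := 0) (by decide) (by decide) (by decide)
    simp only [w1, w2, w3] at k1 k2 k3 k4 k5 k6 k7 k8 k9
    refine ⟨⟨?_, ?_, ?_, ?_, ?_⟩, ⟨?_, ?_, ?_, ?_, ?_⟩, ?_, ?_, ?_, ?_, ?_⟩ <;> split_ifs <;>
      first | exact haf _ _ _ | exact le_rfl | linarith

/-- `1 / pCup p (univ \ {j})` minus `1 / pCup p univ`: the expected number of transmissions, per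
packet, spent while the packet has been overheard by exactly receiver `j`. -/
noncomputable def waitTime (p : Finset (Fin 3) → ℝ) (j : Fin 3) : ℝ :=
  1 / pCup p (univ \ {j}) - 1 / pCup p univ

/-- The rate needed by receiver `i`'s packets overheard by both other receivers. -/
noncomputable def fullRate (p : Finset (Fin 3) → ℝ) (R : Fin 3 → ℝ) (i : Fin 3) : ℝ :=
  R i * (1 / pCup p {i} - 1 / pCup p univ -
    (waitTime p 0 + waitTime p 1 + waitTime p 2 - waitTime p i))

/-- The largest rate at which receiver `i`'s packets overheard by both other receivers can be
moved to the session `{i, j}` regardless of the order on sessions. -/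
noncomputable def moveCap (p : Finset (Fin 3) → ℝ) (R : Fin 3 → ℝ) (i j : Fin 3) : ℝ :=
  R i * (pCup p {i, j} / (pCup p univ * pCup p {i}) - 1 / pCup p univ - waitTime p j)

section rates

variable {p : Finset (Fin 3) → ℝ} {R : Fin 3 → ℝ}

lemma pCup_mono (hp : ∀ S, 0 ≤ p S) {S T : Finset (Fin 3)} (h : S ⊆ T) : pCup p S ≤ pCup p T :=
  Finset.sum_le_sum_of_subset_of_nonneg
    (fun U hU => by
      simp only [mem_filter, mem_univ, true_and] at hU ⊢
      exact hU.mono (Finset.inter_subset_inter_left h))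
    fun _ _ _ => hp _

lemma pCup_pos (hp : ∀ S, 0 ≤ p S) (hpos : ∀ k, 0 < pCup p {k}) {S : Finset (Fin 3)}
    (hS : S.Nonempty) : 0 < pCup p S := by
  obtain ⟨k, hk⟩ := hS
  exact (hpos k).trans_le (pCup_mono hp (Finset.singleton_subset_iff.2 hk))

lemma waitTime_nonneg (hp : ∀ S, 0 ≤ p S) (hpos : ∀ k, 0 < pCup p {k}) (j : Fin 3) :
    0 ≤ waitTime p j := by
  have hne : ((univ : Finset (Fin 3)) \ {j}).Nonempty := by revert j; decide
  exact sub_nonneg.2 (one_div_le_one_div_of_le (pCup_pos hp hpos hne)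
    (pCup_mono hp (Finset.subset_univ _)))

variable {i j k : Fin 3}

lemma waitTime_eq (hij : i ≠ j) (hjk : j ≠ k) (hik : i ≠ k) :
    waitTime p j = 1 / pCup p {i, k} - 1 / pCup p univ := by
  have : (univ : Finset (Fin 3)) \ {j} = {i, k} := by revert i j k; decide
  rw [waitTime, this]

lemma fullRate_eq (hij : i ≠ j) (hjk : j ≠ k) (hik : i ≠ k) :
    fullRate p R i =
      R i * (1 / pCup p {i} + 1 / pCup p univ - 1 / pCup p {i, j} - 1 / pCup p {i, k}) := by
  have : waitTime p 0 + waitTime p 1 + waitTime p 2 - waitTime p i =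
      waitTime p j + waitTime p k := by
    fin_cases i <;> fin_cases j <;> first | exact absurd rfl hij | skip
    all_goals fin_cases k <;> first | exact absurd rfl hik | exact absurd rfl hjk | skip
    all_goals simp <;> ring
  rw [fullRate, this, waitTime_eq hij hjk hik, waitTime_eq hik hjk.symm hij]
  ring

lemma waitTime_mul (hp : ∀ S, 0 ≤ p S) (hpos : ∀ k, 0 < pCup p {k})
    (hij : i ≠ j) (hjk : j ≠ k) (hik : i ≠ k) :
    R i * waitTime p j * pCup p {i, k} = R i / pCup p univ * fp p {j} {i, k} := by
  have h1 : 0 < pCup p {i, k} := pCup_pos hp hpos (by simp)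
  have h2 : 0 < pCup p univ := pCup_pos hp hpos (by simp)
  rw [(fp_eq_pCup_sub p hij hjk hik).1, waitTime_eq hij hjk hik]
  field_simp

lemma moveCap_mul (hp : ∀ S, 0 ≤ p S) (hpos : ∀ k, 0 < pCup p {k})
    (hij : i ≠ j) (hjk : j ≠ k) (hik : i ≠ k) :
    moveCap p R i j * pCup p {i} =
      R i / pCup p univ * fp p {j, k} {i} + R i * waitTime p j * fp p {k} {i} := by
  have h1 : 0 < pCup p {i, k} := pCup_pos hp hpos (by simp)
  have h2 : 0 < pCup p univ := pCup_pos hp hpos (by simp)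
  have h3 := hpos i
  obtain ⟨-, h4, h5⟩ := fp_eq_pCup_sub p hij hjk hik
  rw [h4, h5, moveCap, waitTime_eq hij hjk hik]
  field_simp
  ring

lemma fullRate_sub_moveCap (hp : ∀ S, 0 ≤ p S) (hpos : ∀ k, 0 < pCup p {k})
    (hij : i ≠ j) (hjk : j ≠ k) (hik : i ≠ k) :
    fullRate p R i - moveCap p R i j =
      (moveCap p R i j + R i * waitTime p j) * waitTime p k * pCup p univ := by
  have h1 : 0 < pCup p {i, k} := pCup_pos hp hpos (by simp)
  have h2 : 0 < pCup p univ := pCup_pos hp hpos (by simp)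
  have h3 := hpos i
  have h4 : 0 < pCup p {i, j} := pCup_pos hp hpos (by simp)
  rw [fullRate_eq hij hjk hik, moveCap, waitTime_eq hij hjk hik, waitTime_eq hik hjk.symm hij]
  field_simp
  ring

lemma fullRate_mul (hp : ∀ S, 0 ≤ p S) (hpos : ∀ k, 0 < pCup p {k})
    (hij : i ≠ j) (hjk : j ≠ k) (hik : i ≠ k) :
    fullRate p R i * pCup p {i} = R i / pCup p univ * fp p {j, k} {i} +
      R i * waitTime p j * fp p {k} {i} + R i * waitTime p k * fp p {j} {i} := by
  have h1 : 0 < pCup p {i, k} := pCup_pos hp hpos (by simp)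
  have h2 : 0 < pCup p univ := pCup_pos hp hpos (by simp)
  have h3 := hpos i
  have h4 : 0 < pCup p {i, j} := pCup_pos hp hpos (by simp)
  obtain ⟨-, h5, h6⟩ := fp_eq_pCup_sub p hij hjk hik
  rw [h5, h6, (fp_eq_pCup_sub p hik hjk.symm hij).2.1, fullRate_eq hij hjk hik,
    waitTime_eq hij hjk hik, waitTime_eq hik hjk.symm hij]
  field_simp
  ring

lemma moveCap_nonneg (hp : ∀ S, 0 ≤ p S) (hpos : ∀ k, 0 < pCup p {k})
    (hR : ∀ k, 0 ≤ R k) (hij : i ≠ j) (hjk : j ≠ k) (hik : i ≠ k) : 0 ≤ moveCap p R i j := by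
  refine nonneg_of_mul_nonneg_left ?_ (hpos i)
  rw [moveCap_mul hp hpos hij hjk hik]
  have h2 : 0 < pCup p univ := pCup_pos hp hpos (by simp)
  exact add_nonneg (mul_nonneg (div_nonneg (hR i) h2.le) (fp_nonneg hp _ _))
    (mul_nonneg (mul_nonneg (hR i) (waitTime_nonneg hp hpos j)) (fp_nonneg hp _ _))

lemma moveCap_le_fullRate (hp : ∀ S, 0 ≤ p S) (hpos : ∀ k, 0 < pCup p {k})
    (hR : ∀ k, 0 ≤ R k) (hij : i ≠ j) (hjk : j ≠ k) (hik : i ≠ k) :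
    moveCap p R i j ≤ fullRate p R i := by
  rw [← sub_nonneg, fullRate_sub_moveCap hp hpos hij hjk hik]
  exact mul_nonneg (mul_nonneg (add_nonneg (moveCap_nonneg hp hpos hR hij hjk hik)
    (mul_nonneg (hR i) (waitTime_nonneg hp hpos j))) (waitTime_nonneg hp hpos k))
    (pCup_pos hp hpos (by simp)).le

lemma waitTime_mul_le_fullRate (hp : ∀ S, 0 ≤ p S) (hpos : ∀ k, 0 < pCup p {k})
    (hR : ∀ k, 0 ≤ R k) (hij : i ≠ j) (hjk : j ≠ k) (hik : i ≠ k) :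
    R i * waitTime p j * waitTime p k * pCup p univ ≤ fullRate p R i := by
  have h := mul_sub_mul_sub_le (hpos i) (pCup_mono hp (show ({i} : Finset (Fin 3)) ⊆ {i, j} by simp))
    (pCup_mono hp (show ({i} : Finset (Fin 3)) ⊆ {i, k} by simp)) (pCup_mono hp (subset_univ {i, j}))
    (by linarith [(fp_eq_pCup_sub p hij hjk hik).2.2, fp_nonneg hp {j, k} {i}])
  rw [fullRate_eq hij hjk hik, waitTime_eq hij hjk hik, waitTime_eq hik hjk.symm hij]
  calc _ = R i * ((1 / pCup p {i, k} - 1 / pCup p univ) *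
        (1 / pCup p {i, j} - 1 / pCup p univ) * pCup p univ) := by ring
    _ ≤ _ := mul_le_mul_of_nonneg_left h (hR i)

end rates

lemma exists_lpFeasible_of_dominance {p : Finset (Fin 3) → ℝ} (hp : ∀ S, 0 ≤ p S)
    (hpos : ∀ k : Fin 3, 0 < pCup p {k}) {R : Fin 3 → ℝ} (hR : ∀ k, 0 ≤ R k)
    (houter : ∀ {i j k : Fin 3}, i ≠ j → j ≠ k → i ≠ k →
      R i / pCup p {i} + R j / pCup p {i, j} + R k / pCup p univ < 1)
    {ord : Finset (Fin 3) → Finset (Fin 3) → Prop} (hord : CardCompatible ord)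
    {i j k : Fin 3} (hij : i ≠ j) (hjk : j ≠ k) (hik : i ≠ k)
    (dij : R j * waitTime p i ≤ R i * waitTime p j)
    (dik : R k * waitTime p i ≤ R i * waitTime p k)
    (djk : R k * waitTime p j ≤ R j * waitTime p k) :
    ∃ (x : Finset (Fin 3) → ℝ) (w : Fin 3 → Finset (Fin 3) → Finset (Fin 3) → ℝ),
      LPFeasible p R ord x w := by
  have hP : 0 < pCup p univ := pCup_pos hp hpos (by simp)
  have hwait := waitTime_nonneg hp hpos
  have hfull : ∀ {i j k : Fin 3}, i ≠ j → j ≠ k → i ≠ k → 0 ≤ fullRate p R i :=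
    fun h1 h2 h3 => (moveCap_nonneg hp hpos hR h1 h2 h3).trans
      (moveCap_le_fullRate hp hpos hR h1 h2 h3)
  have hbound : ∀ {x y z : Fin 3} {B : ℝ}, x ≠ y → y ≠ z → x ≠ z →
      moveCap p R x y ≤ B - R x * waitTime p y →
      B * waitTime p z * pCup p univ ≤ fullRate p R i →
      fullRate p R x - moveCap p R x y ≤ fullRate p R i := by
    intro x y z B h1 h2 h3 h4 h5
    rw [fullRate_sub_moveCap hp hpos h1 h2 h3]
    refine le_trans ?_ h5
    have := hwait z
    gcongr
    linarith
  have hi := waitTime_mul_le_fullRate hp hpos hR hij hjk hik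
  have houter' : ∀ {x y z : Fin 3}, x ≠ y → y ≠ z → x ≠ z →
      R x / pCup p univ + R y / pCup p univ + R z / pCup p univ + R x * waitTime p y +
        R x * waitTime p z + R y * waitTime p z + fullRate p R x < 1 := by
    intro x y z h1 h2 h3
    refine lt_of_eq_of_lt ?_ (houter h1 h2 h3)
    rw [fullRate_eq h1 h2 h3, waitTime_eq h1 h2 h3, waitTime_eq h3 h2.symm h1]
    ring
  obtain ⟨mji, mki, mkj, X, a1, a2, a3, a4, a5, a6, a7, a8, a9, a10, a11, a12, a13, a14, a15⟩ :=
    exists_moves (A := R i / pCup p univ + R j / pCup p univ + R k / pCup p univ)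
      (hfull hij hjk hik) (hfull hij.symm hik hjk) (hfull hik.symm hij hjk.symm)
      (moveCap_nonneg hp hpos hR hij.symm hik hjk)
      (moveCap_nonneg hp hpos hR hik.symm hij hjk.symm)
      (moveCap_nonneg hp hpos hR hjk.symm hij.symm hik.symm)
      (moveCap_le_fullRate hp hpos hR hij.symm hik hjk)
      (moveCap_le_fullRate hp hpos hR hik.symm hij hjk.symm)
      (moveCap_le_fullRate hp hpos hR hjk.symm hij.symm hik.symm)
      (fun h => hbound hij.symm hik hjk h hi)
      (fun h => hbound hik.symm hij hjk.symm h (by linarith))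
      (fun h => hbound hjk.symm hij.symm hik.symm h (by
        refine le_trans ?_ hi
        have := mul_le_mul_of_nonneg_right dij (mul_nonneg (hwait k) hP.le)
        linarith))
      dij dik djk (houter' hij hjk hik)
      (by linarith [houter' hij.symm hik hjk])
      (by linarith [houter' hik.symm hij hjk.symm])
  obtain ⟨m, m1, m2, m3, m4, m5, m6⟩ : ∃ m : Fin 3 → Fin 3 → ℝ, m i j = 0 ∧ m i k = 0 ∧
      m j k = 0 ∧ m j i = mji ∧ m k i = mki ∧ m k j = mkj :=
    ⟨fun x y => if x = j ∧ y = i then mji else if x = k ∧ y = i then mki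
      else if x = k ∧ y = j then mkj else 0, by
      simp [hij, hjk, hik, hij.symm, hjk.symm, hik.symm]⟩
  have hcases : ∀ x, x = i ∨ x = j ∨ x = k := by intro x; omega
  have hm : ∀ x y, x ≠ y → 0 ≤ m x y ∧ m x y ≤ moveCap p R x y ∧
      R x * waitTime p y + m x y ≤ max (R x * waitTime p y) (R y * waitTime p x) := by
    intro x y h
    rcases hcases x with rfl | rfl | rfl <;> rcases hcases y with rfl | rfl | rfl <;>
      first | exact absurd rfl h | skip
    · rw [m1, max_eq_left dij]
      exact ⟨le_rfl, moveCap_nonneg hp hpos hR hij hjk hik, by linarith⟩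
    · rw [m2, max_eq_left dik]
      exact ⟨le_rfl, moveCap_nonneg hp hpos hR hik hjk.symm hij, by linarith⟩
    · rw [m4, max_eq_right dij]
      exact ⟨a1, a7, by linarith⟩
    · rw [m3, max_eq_left djk]
      exact ⟨le_rfl, moveCap_nonneg hp hpos hR hjk hik.symm hij.symm, by linarith⟩
    · rw [m5, max_eq_right dik]
      exact ⟨a2, a8, by linarith⟩
    · rw [m6, max_eq_right djk]
      exact ⟨a3, a9, by linarith⟩
  have hmc : ∀ x y z, x ≠ y → y ≠ z → x ≠ z →
      m x y + m x z ≤ fullRate p R x ∧ fullRate p R x - (m x y + m x z) ≤ X := by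
    intro x y z h1 h2 h3
    rcases hcases x with rfl | rfl | rfl <;> rcases hcases y with rfl | rfl | rfl <;>
      first | exact absurd rfl h1 | skip
    all_goals
      rcases hcases z with rfl | rfl | rfl <;>
        first | exact absurd rfl h2 | exact absurd rfl h3 | skip
    all_goals
      simp only [m1, m2, m3, m4, m5, m6]
      constructor <;> linarith [hfull hij hjk hik]
  refine ⟨_, _, lpFeasible_sessionRate hp hord (a := fun x => R x / pCup p univ)
    (b := fun x y => R x * waitTime p y) (c := fullRate p R) (m := fun x y => max (m x y) 0)
    (y := fun x y => max (R x * waitTime p y) (R y * waitTime p x)) (X := X)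
    (fun x => div_nonneg (hR x) hP.le) (fun x y => mul_nonneg (hR x) (hwait y))
    (fun _ _ => le_max_right _ _)
    ((hfull hij hjk hik).trans a12) (fun x => div_mul_cancel₀ _ hP.ne')
    (fun x y z h1 h2 h3 => waitTime_mul hp hpos h1 h2 h3)
    (fun x y z h1 h2 h3 => fullRate_mul hp hpos h1 h2 h3) ?_ ?_ ?_ (fun x y => max_comm _ _) ?_ ?_⟩
  · intro x y z h1 h2 h3
    rw [max_eq_left (hm x y h1).1, ← moveCap_mul hp hpos h1 h2 h3]
    exact mul_le_mul_of_nonneg_right (hm x y h1).2.1 (hpos x).le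
  · intro x y z h1 h2 h3
    rw [max_eq_left (hm x y h1).1, max_eq_left (hm x z h3).1]
    exact (hmc x y z h1 h2 h3).1
  · intro x y h
    rw [max_eq_left (hm x y h).1]
    exact (hm x y h).2.2
  · intro x y z h1 h2 h3
    rw [max_eq_left (hm x y h1).1, max_eq_left (hm x z h3).1]
    exact (hmc x y z h1 h2 h3).2
  · have hsum : ∀ (f : Fin 3 → ℝ) (g : Fin 3 → Fin 3 → ℝ), (∀ x y, g x y = g y x) →
        f 0 + f 1 + f 2 + g 0 1 + g 0 2 + g 1 2 = f i + f j + f k + g i j + g i k + g j k := by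
      intro f g hg
      fin_cases i <;> fin_cases j <;> first | exact absurd rfl hij | skip
      all_goals fin_cases k <;> first | exact absurd rfl hik | exact absurd rfl hjk | skip
      all_goals
        simp only [Fin.zero_eta, Fin.mk_one, Fin.reduceFinMk, hg 1 0, hg 2 0, hg 2 1] <;> ring
    rw [hsum (fun x => R x / pCup p univ)
      (fun x y => max (R x * waitTime p y) (R y * waitTime p x)) fun _ _ => max_comm _ _]
    simp only [max_eq_left dij, max_eq_left dik, max_eq_left djk]
    exact a15

/-- A complete relation given by comparing slopes of vectors in the first quadrant has no strict
cycle of length three. -/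
lemma not_strict_cycle {r s t x y z : ℝ} (hr : 0 ≤ r) (hs : 0 ≤ s) (ht : 0 ≤ t) (hx : 0 ≤ x)
    (hy : 0 ≤ y) (hz : 0 ≤ z) (h1 : s * x < r * y) (h2 : t * y < s * z) (h3 : r * z < t * x) :
    False := by
  have := mul_lt_mul'' (mul_lt_mul'' h1 h2 (by positivity) (by positivity)) h3 (by positivity)
    (by positivity)
  linarith

/-- For a 1-to-3 broadcast PEC with positive marginal success probabilities, any nonnegative
rate vector satisfying all `3!` strict outer-bound inequalities admits LP-feasible variables
with respect to every cardinality-compatible strict total order: the achievability core of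
the result that the outer bound is the capacity region for all 1-to-3 broadcast PECs with
channel output feedback. -/
theorem stmt12 (p : Finset (Fin 3) → ℝ)
    (hp : ∀ S, 0 ≤ p S) (hsum : ∑ S : Finset (Fin 3), p S = 1)
    (hpos : ∀ k : Fin 3, 0 < pCup p {k})
    (R : Fin 3 → ℝ) (hR : ∀ k, 0 ≤ R k)
    (houter : ∀ π : Equiv.Perm (Fin 3),
      ∑ j : Fin 3,
        R (π j) / pCup p ((Finset.univ.filter (fun i : Fin 3 => i ≤ j)).image π) < 1) :
    ∀ ord : Finset (Fin 3) → Finset (Fin 3) → Prop, CardCompatible ord →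
      ∃ (x : Finset (Fin 3) → ℝ) (w : Fin 3 → Finset (Fin 3) → Finset (Fin 3) → ℝ),
        LPFeasible p R ord x w := by
  intro ord hord
  have core := fun {i j k : Fin 3} (hij : i ≠ j) (hjk : j ≠ k) (hik : i ≠ k) =>
    exists_lpFeasible_of_dominance hp hpos hR (sum_outer_lt_one houter) hord hij hjk hik
  have hwait := waitTime_nonneg hp hpos
  have hcyc : ∀ i j k : Fin 3, R j * waitTime p i < R i * waitTime p j →
      R k * waitTime p j < R j * waitTime p k → R i * waitTime p k < R k * waitTime p i → False :=
    fun i j k => not_strict_cycle (hR i) (hR j) (hR k) (hwait i) (hwait j) (hwait k)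
  have c1 := core (i := 0) (j := 1) (k := 2) (by decide) (by decide) (by decide)
  have c2 := core (i := 0) (j := 2) (k := 1) (by decide) (by decide) (by decide)
  have c3 := core (i := 1) (j := 0) (k := 2) (by decide) (by decide) (by decide)
  have c4 := core (i := 1) (j := 2) (k := 0) (by decide) (by decide) (by decide)
  have c5 := core (i := 2) (j := 0) (k := 1) (by decide) (by decide) (by decide)
  have c6 := core (i := 2) (j := 1) (k := 0) (by decide) (by decide) (by decide)
  have h1 := hcyc 0 1 2
  have h2 := hcyc 0 2 1
  grind
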